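/- arXiv:2205.11468 — 4 statements merged into one kernel-verified Lean document; each statement's English description precedes it below -/
import Mathlib

section
/- Let C ≥ 1 and δ ∈ (0,1). Let b : [1,∞) → (0,1] be antitone (nonincreasing) and satisfy b(s + r + 1) ≤ C · b(s) · b(r) for all s, r ≥ 1, as well as b(r) ≥ δ^r for all r ≥ 1. Then there exists ξ ∈ [0, log(1/δ)] such that (log b(r))/r → −ξ as r → ∞, and moreover b(r) ≥ C⁻¹ · e^{−ξ(r+1)} for every r ≥ 1. -/
open Filter Real

/-- Shifted sub-multiplicativity (Fekete-type) argument: if `b : [1,∞) → (0,1]` is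
nonincreasing, satisfies `b (s + r + 1) ≤ C * b s * b r`, and `b r ≥ δ ^ r`, then
`(log (b r)) / r` converges to `−ξ` for some `ξ ∈ [0, log (1/δ)]`, and moreover
`b r ≥ C⁻¹ * exp (−ξ * (r + 1))` for all `r ≥ 1`. -/
theorem exists_exponent_of_shifted_submultiplicative
    (C δ : ℝ) (hC : 1 ≤ C) (hδ : δ ∈ Set.Ioo (0 : ℝ) 1)
    (b : ℝ → ℝ)
    (hanti : AntitoneOn b (Set.Ici 1))
    (hrange : ∀ r : ℝ, 1 ≤ r → b r ∈ Set.Ioc (0 : ℝ) 1)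
    (hsub : ∀ s r : ℝ, 1 ≤ s → 1 ≤ r → b (s + r + 1) ≤ C * b s * b r)
    (hlow : ∀ r : ℝ, 1 ≤ r → δ ^ r ≤ b r) :
    ∃ ξ : ℝ, ξ ∈ Set.Icc 0 (Real.log (1 / δ)) ∧
      Tendsto (fun r : ℝ => Real.log (b r) / r) atTop (nhds (-ξ)) ∧
      ∀ r : ℝ, 1 ≤ r → C⁻¹ * Real.exp (-ξ * (r + 1)) ≤ b r := by
  obtain ⟨hδ0, hδ1⟩ := hδ
  have hC0 : 0 < C := by linarith
  have hlC : 0 ≤ Real.log C := Real.log_nonneg hC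
  have hlδ : Real.log δ < 0 := Real.log_neg hδ0 hδ1
  obtain ⟨a, ha⟩ : ∃ a : ℝ → ℝ, ∀ t, a t = Real.log C + Real.log (b (t - 1)) := ⟨_, fun _ => rfl⟩
  have hpos : ∀ t, 2 ≤ t → 0 < b (t - 1) := fun t ht => (hrange (t - 1) (by linarith)).1
  have hasub : ∀ s t, 2 ≤ s → 2 ≤ t → a (s + t) ≤ a s + a t := by
    intro s t hs ht
    have h := hsub (s - 1) (t - 1) (by linarith) (by linarith)
    rw [show s - 1 + (t - 1) + 1 = s + t - 1 by ring] at h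
    have h2 := Real.log_le_log (hpos (s + t) (by linarith)) h
    rw [Real.log_mul (mul_pos hC0 (hpos s hs)).ne' (hpos t ht).ne',
      Real.log_mul hC0.ne' (hpos s hs).ne'] at h2
    rw [ha, ha, ha]; linarith
  have haanti : ∀ s t, 2 ≤ s → s ≤ t → a t ≤ a s := by
    intro s t hs hst
    have h : b (t - 1) ≤ b (s - 1) := hanti (by simp; linarith) (by simp; linarith) (by linarith)
    have h2 := Real.log_le_log (hpos t (by linarith)) h
    rw [ha, ha]; linarith
  have halow : ∀ t, 2 ≤ t → Real.log δ * t ≤ a t := by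
    intro t ht
    have h := Real.log_le_log (Real.rpow_pos_of_pos hδ0 _) (hlow (t - 1) (by linarith))
    rw [Real.log_rpow hδ0] at h
    rw [ha]; nlinarith
  have haup : ∀ t, 2 ≤ t → a t ≤ Real.log C := by
    intro t ht
    have h := Real.log_nonpos (hpos t ht).le (hrange (t - 1) (by linarith)).2
    rw [ha]; linarith
  have hmul : ∀ t, 2 ≤ t → ∀ k : ℕ, a (((k : ℝ) + 1) * t) ≤ ((k : ℝ) + 1) * a t := by
    intro t ht k
    induction k with
    | zero => simp
    | succ k ih =>
      have hk : (0 : ℝ) ≤ k := k.cast_nonneg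
      have h := hasub (((k : ℝ) + 1) * t) t (by nlinarith) ht
      push_cast
      rw [show ((k : ℝ) + 1 + 1) * t = ((k : ℝ) + 1) * t + t by ring]
      linarith
  obtain ⟨S, hS⟩ : ∃ S : Set ℝ, S = (fun t => a t / t) '' Set.Ici 2 := ⟨_, rfl⟩
  have hlb : ∀ x ∈ S, Real.log δ ≤ x := by
    intro x hx
    rw [hS] at hx
    obtain ⟨t, ht, rfl⟩ := hx
    have ht : 2 ≤ t := ht
    exact (le_div_iff₀ (by linarith)).2 (halow t ht)
  have hne : S.Nonempty := by rw [hS]; exact ⟨_, 2, Set.self_mem_Ici, rfl⟩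
  have hbdd : BddBelow S := ⟨_, hlb⟩
  obtain ⟨L, hL⟩ : ∃ L, L = sInf S := ⟨_, rfl⟩
  have hLle : ∀ t, 2 ≤ t → L * t ≤ a t := by
    intro t ht
    have : L ≤ a t / t := by rw [hL]; exact csInf_le hbdd (by rw [hS]; exact ⟨t, ht, rfl⟩)
    exact (le_div_iff₀ (by linarith)).1 this
  have hLδ : Real.log δ ≤ L := by rw [hL]; exact le_csInf hne hlb
  have hL0 : L ≤ 0 := by
    by_contra! h
    have h1 := hLle (2 + Real.log C / L) (by have := div_nonneg hlC h.le; linarith)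
    have h2 := haup (2 + Real.log C / L) (by have := div_nonneg hlC h.le; linarith)
    rw [mul_add, mul_div_cancel₀ _ h.ne'] at h1
    linarith
  have hba : ∀ r, a (r + 1) = Real.log C + Real.log (b r) := by
    intro r; rw [ha, add_sub_cancel_right]
  have htail : ∀ u K : ℝ, Tendsto (fun r : ℝ => u + K / r) atTop (nhds u) := by
    intro u K
    simpa using (tendsto_const_nhds (x := u)).add (tendsto_const_nhds.div_atTop tendsto_id)
  refine ⟨-L, ⟨by linarith, by rw [one_div, Real.log_inv]; linarith⟩, ?_, ?_⟩
  · rw [neg_neg, tendsto_order]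
    constructor
    · intro M hM
      filter_upwards [(htail L (L - Real.log C)).eventually (lt_mem_nhds hM), eventually_ge_atTop 1]
        with r hr hr1
      refine hr.trans_le ?_
      have hr0 : 0 < r := by linarith
      have h := hLle (r + 1) (by linarith)
      rw [hba] at h
      rw [le_div_iff₀ hr0, add_mul, div_mul_cancel₀ _ hr0.ne']
      linarith
    · intro M hM
      rw [hL] at hM
      obtain ⟨x, hx, hxM⟩ := exists_lt_of_csInf_lt hne hM
      rw [hS] at hx
      obtain ⟨t, ht, rfl⟩ := hx
      have ht : 2 ≤ t := ht
      have ht0 : 0 < t := by linarith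
      filter_upwards [(htail (a t / t) (|a t / t| + |a t|)).eventually (gt_mem_nhds hxM),
        eventually_ge_atTop 1, eventually_ge_atTop t] with r hr hr1 hrt
      refine lt_of_le_of_lt ?_ hr
      have hr0 : 0 < r := by linarith
      rw [div_le_iff₀ hr0, add_mul, div_mul_cancel₀ _ hr0.ne']
      have hq : 1 ≤ (r + 1) / t := (le_div_iff₀ ht0).2 (by linarith)
      have hf1 : 1 ≤ ⌊(r + 1) / t⌋₊ := Nat.le_floor (by simpa using hq)
      obtain ⟨k, hk⟩ : ∃ k, ⌊(r + 1) / t⌋₊ = k + 1 := ⟨_, (Nat.sub_add_cancel hf1).symm⟩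
      have h1 : ((k : ℝ) + 1) ≤ (r + 1) / t := by
        have := Nat.floor_le (show 0 ≤ (r + 1) / t by linarith)
        rw [hk] at this; push_cast at this; exact this
      have h2 : (r + 1) / t < (k : ℝ) + 1 + 1 := by
        have := Nat.lt_floor_add_one ((r + 1) / t)
        rw [hk] at this; push_cast at this; exact this
      have hk0 : (0 : ℝ) ≤ k := k.cast_nonneg
      have h3 := haanti (((k : ℝ) + 1) * t) (r + 1) (by nlinarith) ((le_div_iff₀ ht0).1 h1)
      have h4 := hmul t ht k
      have h5 : ((k : ℝ) + 1) * a t ≤ (r + 1) / t * a t + |a t| := by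
        rcases abs_cases (a t) with ⟨h, _⟩ | ⟨h, _⟩ <;> rw [h] <;> nlinarith
      have h6 : (r + 1) / t * a t = a t / t * r + a t / t := by field_simp
      have h7 := le_abs_self (a t / t)
      rw [hba] at h3
      linarith
  · intro r hr
    have h := hLle (r + 1) (by linarith)
    rw [hba] at h
    have hb := (hrange r hr).1
    rw [neg_neg, inv_mul_le_iff₀ hC0, ← Real.le_log_iff_exp_le (mul_pos hC0 hb),
      Real.log_mul hC0.ne' hb.ne']
    exact h
end

section
/- Let b : [1,∞) → (0,∞) be antitone (nonincreasing) and suppose there exist constants C₀ ≥ c₀ > 0 such that for all s, r ≥ 1 one has b(s + r + 1) ≤ C₀ · b(s) · b(r) and b(s + r + 2) ≥ c₀ · b(s) · b(r). Then there exist ξ ∈ ℝ and constants 0 < C₁ ≤ C₂ such that C₁ · e^{−ξ r} ≤ b(r) ≤ C₂ · e^{−ξ r} for all r ≥ 1. -/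
open Real

lemma aux_log (f : ℝ → ℝ) (k K : ℝ)
    (hanti : ∀ x y : ℝ, 1 ≤ x → x ≤ y → f y ≤ f x)
    (hsub : ∀ s r : ℝ, 1 ≤ s → 1 ≤ r → f (s + r + 1) ≤ K + f s + f r)
    (hsuper : ∀ s r : ℝ, 1 ≤ s → 1 ≤ r → k + f s + f r ≤ f (s + r + 2))
    (x y : ℝ) (hx : 2 ≤ x) (hy : 3 ≤ y) :
    (f (y - 2) + k) / y ≤ (f (x - 1) + K) / x := by
  have hU : ∀ m : ℕ, f ((m + 1 : ℕ) * x - 1) + K ≤ (m + 1 : ℕ) * (f (x - 1) + K) := by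
    intro m
    induction m with
    | zero => simp
    | succ m ih =>
      have h0 : (0:ℝ) ≤ m * x := by positivity
      push_cast at ih ⊢
      have h := hsub ((m + 1) * x - 1) (x - 1) (by nlinarith) (by linarith)
      rw [show ((m:ℝ) + 1) * x - 1 + (x - 1) + 1 = (m + 1 + 1) * x - 1 by ring] at h
      linarith
  have hV : ∀ m : ℕ, (m + 1 : ℕ) * (f (y - 2) + k) ≤ f ((m + 1 : ℕ) * y - 2) + k := by
    intro m
    induction m with
    | zero => simp
    | succ m ih =>
      have h0 : (0:ℝ) ≤ m * y := by positivity
      push_cast at ih ⊢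
      have h := hsuper ((m + 1) * y - 2) (y - 2) (by nlinarith) (by linarith)
      rw [show ((m:ℝ) + 1) * y - 2 + (y - 2) + 2 = (m + 1 + 1) * y - 2 by ring] at h
      linarith
  set A := f (x - 1) + K with hA
  set B := f (y - 2) + k with hB
  have hx0 : 0 < x := by linarith
  have hy0 : 0 < y := by linarith
  have key : ∀ n : ℕ, x ≤ n → n * (B - y * (A / x)) ≤ |A| - K - f 1 := by
    intro n hn
    have hny : x ≤ n * y := by nlinarith
    have hfl1 := Nat.floor_le (show 0 ≤ n * y / x by positivity)
    have hfl2 := Nat.lt_floor_add_one (n * y / x)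
    have hm1 : 1 ≤ ⌊n * y / x⌋₊ := Nat.le_floor (by rw [Nat.cast_one, le_div_iff₀ hx0]; linarith)
    obtain ⟨m, hm⟩ := Nat.exists_eq_add_of_le' hm1
    have hn1 : 1 ≤ n := by
      have : (0:ℝ) < n := by linarith
      exact_mod_cast this
    obtain ⟨p, rfl⟩ := Nat.exists_eq_add_of_le' hn1
    rw [hm] at hfl1 hfl2
    have h1 := hU m
    have h2 := hV p
    have hmx : ((m + 1 : ℕ) : ℝ) * x ≤ (p + 1 : ℕ) * y := by
      rwa [le_div_iff₀ hx0] at hfl1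
    have hm2 : 2 ≤ ((m + 1 : ℕ) : ℝ) * x := by
      have h0 : (0:ℝ) ≤ m * x := by positivity
      push_cast; nlinarith
    have hp3 : 3 ≤ ((p + 1 : ℕ) : ℝ) * y := by
      have h0 : (0:ℝ) ≤ p * y := by positivity
      push_cast; nlinarith
    generalize ((p + 1 : ℕ) : ℝ) = N at *
    generalize ((m + 1 : ℕ) : ℝ) = M at *
    have h3 := hanti (M * x - 1) (N * y - 1) (by linarith) (by linarith)
    have h4 := hsuper (N * y - 2) 1 (by linarith) le_rfl
    have h5 := hanti (N * y - 1) (N * y - 2 + 1 + 2) (by linarith) (by linarith)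
    have h6 : (M - N * y / x) * A ≤ |A| := by
      calc _ ≤ |(M - N * y / x) * A| := le_abs_self _
        _ = |M - N * y / x| * |A| := abs_mul _ _
        _ ≤ 1 * |A| := by
          gcongr
          rw [abs_le]; constructor <;> linarith
        _ = |A| := one_mul _
    have h7 : N * (B - y * (A / x)) = N * B - N * y / x * A := by ring
    rw [h7]
    linarith
  have hd : B - y * (A / x) ≤ 0 := by
    by_contra! hd
    obtain ⟨n, hn⟩ := exists_nat_ge (max x ((|A| - K - f 1 + 1) / (B - y * (A / x))))
    have h1 := key n ((le_max_left _ _).trans hn)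
    have h2 := (le_max_right _ _).trans hn
    rw [div_le_iff₀ hd] at h2
    linarith
  rw [div_le_iff₀ hy0]
  linarith

/-- Analytic skeleton of the up-to-constants estimate: a positive nonincreasing
function on `[1,∞)` satisfying a shifted sub-multiplicative upper bound and a
shifted super-multiplicative lower bound is comparable, up to constants, to
`exp (−ξ r)` for a single exponent `ξ`. -/
theorem up_to_constants_of_sub_and_super_multiplicative
    (b : ℝ → ℝ) (c₀ C₀ : ℝ) (hc₀ : 0 < c₀) (hC₀ : c₀ ≤ C₀)
    (hanti : AntitoneOn b (Set.Ici 1))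
    (hpos : ∀ r : ℝ, 1 ≤ r → 0 < b r)
    (hsub : ∀ s r : ℝ, 1 ≤ s → 1 ≤ r → b (s + r + 1) ≤ C₀ * b s * b r)
    (hsuper : ∀ s r : ℝ, 1 ≤ s → 1 ≤ r → c₀ * b s * b r ≤ b (s + r + 2)) :
    ∃ ξ C₁ C₂ : ℝ, 0 < C₁ ∧ C₁ ≤ C₂ ∧
      ∀ r : ℝ, 1 ≤ r → C₁ * Real.exp (-ξ * r) ≤ b r ∧ b r ≤ C₂ * Real.exp (-ξ * r) := by
  have hC : 0 < C₀ := by linarith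
  have key := aux_log (fun x => log (b x)) (log c₀) (log C₀)
    (fun x y hx hxy => log_le_log (hpos y (by linarith))
      (hanti (Set.mem_Ici.2 hx) (Set.mem_Ici.2 (by linarith)) hxy))
    (fun s r hs hr => by
      have h := log_le_log (hpos _ (by linarith)) (hsub s r hs hr)
      have h1 := hpos s hs
      have h2 := hpos r hr
      rwa [log_mul (by positivity) (by positivity), log_mul (by positivity) (by positivity)] at h)
    (fun s r hs hr => by
      have h1 := hpos s hs
      have h2 := hpos r hr
      have h := log_le_log (by positivity) (hsuper s r hs hr)
      rwa [log_mul (by positivity) (by positivity), log_mul (by positivity) (by positivity)] at h)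
  obtain ⟨a, ha1, ha2⟩ := exists_between_of_forall_le
    (s := (fun y : ℝ => (log (b (y - 2)) + log c₀) / y) '' Set.Ici 3)
    (t := (fun x : ℝ => (log (b (x - 1)) + log C₀) / x) '' Set.Ici 2)
    (Set.nonempty_Ici.image _) (Set.nonempty_Ici.image _)
    (by rintro _ ⟨y, hy, rfl⟩ _ ⟨x, hx, rfl⟩; exact key x y hx hy)
  have main : ∀ r : ℝ, 1 ≤ r → exp (a - log C₀) * exp (-(-a) * r) ≤ b r ∧
      b r ≤ exp (2 * a - log c₀) * exp (-(-a) * r) := by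
    intro r hr
    have h1 := ha1 (Set.mem_image_of_mem _ (Set.mem_Ici.2 (show (3:ℝ) ≤ r + 2 by linarith)))
    have h2 := ha2 (Set.mem_image_of_mem _ (Set.mem_Ici.2 (show (2:ℝ) ≤ r + 1 by linarith)))
    simp only [add_sub_cancel_right] at h1 h2
    rw [div_le_iff₀ (by linarith)] at h1
    rw [le_div_iff₀ (by linarith)] at h2
    rw [← exp_add, ← exp_add, ← le_log_iff_exp_le (hpos r hr), ← log_le_iff_le_exp (hpos r hr)]
    constructor <;> linarith
  refine ⟨-a, _, _, exp_pos _, ?_, main⟩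
  have h := main 1 le_rfl
  exact le_of_mul_le_mul_right (h.1.trans h.2) (exp_pos _)
end

section
/- For every c ∈ [0,1] and every real β ≥ 6, ξ_c(β) > 2. In particular ξ_c(6) > 2 for all c ∈ [0,1]. -/
open Set

/-- The generalized disconnection exponent in the `c`-parametrization:
`ξ_c(β) = (1/48)((√(24β + 1 − c) − √(1 − c))² − 4(1 − c))`. -/
noncomputable def xi (c β : ℝ) : ℝ :=
  (1 / 48) * ((Real.sqrt (24 * β + 1 - c) - Real.sqrt (1 - c)) ^ 2 - 4 * (1 - c))

/-- For every `c ∈ [0,1]` and every `β ≥ 6`, `ξ_c(β) > 2`; in particular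
`ξ_c(6) > 2`. -/
theorem xi_gt_two (c : ℝ) (hc : c ∈ Icc (0 : ℝ) 1) :
    (∀ β : ℝ, 6 ≤ β → 2 < xi c β) ∧ 2 < xi c 6 := by
  have key : ∀ β : ℝ, 6 ≤ β → 2 < xi c β := by
    intro β hβ
    obtain ⟨h0, h1⟩ := hc
    unfold xi
    have hs : Real.sqrt (1 - c) ≤ 1 := Real.sqrt_le_one.mpr (by linarith)
    have ht : 12 ≤ Real.sqrt (24 * β + 1 - c) := Real.le_sqrt_of_sq_le (by linarith)
    nlinarith
  exact ⟨key, key 6 le_rfl⟩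
end

section
/- For every c ∈ (0,1], 2 − ξ_c(2) < 1 + κ(c)/8, where ξ_c(2) = (1/48)·((√(49 − c) − √(1 − c))² − 4(1 − c)) and κ(c) = (13 − c − √((1 − c)(25 − c)))/3; in the limiting case c = 0 the two sides are equal (both equal 4/3). -/
open Set

/-- The inverse intensity–parameter correspondence
`κ(c) = (13 − c − √((1 − c)(25 − c)))/3`. -/
noncomputable def kappaOf (c : ℝ) : ℝ := (13 - c - Real.sqrt ((1 - c) * (25 - c))) / 3

/-- For `c ∈ (0,1]`, the dimension `2 − ξ_c(2)` of simple points is strictly less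
than the boundary dimension `1 + κ(c)/8`; at `c = 0` both equal `4/3`. -/
theorem simple_points_dim_lt_boundary_dim :
    (∀ c ∈ Ioc (0 : ℝ) 1, 2 - xi c 2 < 1 + kappaOf c / 8) ∧
    2 - xi 0 2 = 1 + kappaOf 0 / 8 ∧
    2 - xi 0 2 = 4 / 3 := by
  have e1 : Real.sqrt 49 = 7 := by
    rw [show (49 : ℝ) = 7 ^ 2 by norm_num]; exact Real.sqrt_sq (by norm_num)
  have e2 : Real.sqrt 25 = 5 := by
    rw [show (25 : ℝ) = 5 ^ 2 by norm_num]; exact Real.sqrt_sq (by norm_num)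
  refine ⟨?_, ?_, ?_⟩
  · rintro c ⟨h0, h1⟩
    unfold xi kappaOf
    have hs := Real.sq_sqrt (show (0 : ℝ) ≤ 1 - c by linarith)
    have ha := Real.sq_sqrt (show (0 : ℝ) ≤ 24 * 2 + 1 - c by linarith)
    have hs0 := Real.sqrt_nonneg (1 - c)
    have ha0 := Real.sqrt_nonneg (24 * 2 + 1 - c)
    have hb : Real.sqrt ((1 - c) * (25 - c)) < 5 := by
      rw [Real.sqrt_lt' (by norm_num)]; nlinarith
    have hs1 : Real.sqrt (1 - c) ≤ 1 := by
      rw [Real.sqrt_le_left (by norm_num)]; linarith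
    have ha1 : Real.sqrt (24 * 2 + 1 - c) ≤ 7 := by
      rw [Real.sqrt_le_left (by norm_num)]; linarith
    have hp : Real.sqrt (1 - c) * Real.sqrt (24 * 2 + 1 - c) ≤ 1 * 7 :=
      mul_le_mul hs1 ha1 ha0 (by norm_num)
    generalize Real.sqrt (1 - c) = s at *
    generalize Real.sqrt (24 * 2 + 1 - c) = a at *
    generalize Real.sqrt ((1 - c) * (25 - c)) = b at *
    have e : (a - s) ^ 2 = a ^ 2 - 2 * (s * a) + s ^ 2 := by ring
    rw [e, ha, hs]
    linarith
  · unfold xi kappaOf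
    norm_num [e1, e2]
  · unfold xi
    norm_num [e1]
end
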